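/- Let u ≥ 2 be an integer, q a prime power with q ≡ 2^u + 1 (mod 2^{u+1}), t ≥ u+1 an integer, N = 2^t and f = 2^{t−u}. If χ is a multiplicative character of F_{q^f} of order N, then G_{q^f}(χ^{2^u ℓ + 1}) = G_{q^f}(χ) for every nonnegative integer ℓ. -/

import Mathlib

open Finset
open scoped Classical

/-- The canonical additive character `ψ(x) = ζ_p^(Tr_{Q/p}(x))` of a finite
field, where `p` is the characteristic. -/
noncomputable def psiF (F : Type) [Field F] [Fintype F] : F → ℂ :=
  letI := ZMod.algebra F (ringChar F)
  fun x => Complex.exp (2 * Real.pi * Complex.I *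
    ((Algebra.trace (ZMod (ringChar F)) F x).val : ℂ) / (ringChar F : ℂ))

/-- The Gauss sum `G_Q(χ) = ∑_{x ∈ F_Q^*} χ(x) ψ(x)` with respect to the
canonical additive character. -/
noncomputable def gaussF {F : Type} [Field F] [Fintype F] (χ : MulChar F ℂ) : ℂ :=
  ∑ x ∈ (Finset.univ \ {0} : Finset F), χ x * psiF F x

/-- The canonical additive character is invariant under the absolute Frobenius. -/
lemma psiF_pow_ringChar (F : Type) [Field F] [Fintype F] (x : F) :
    psiF F (x ^ ringChar F) = psiF F x := by
  let _ := ZMod.algebra F (ringChar F)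
  have : Fact (ringChar F).Prime := ⟨CharP.char_is_prime F _⟩
  have h := Algebra.trace_eq_of_algEquiv
    (FiniteField.frobeniusAlgEquivOfAlgebraic (ZMod (ringChar F)) F) x
  rw [FiniteField.coe_frobeniusAlgEquivOfAlgebraic, ZMod.card] at h
  simp only [psiF]
  exact congrArg (fun y : ZMod (ringChar F) => Complex.exp (2 * Real.pi * Complex.I *
    (y.val : ℂ) / (ringChar F : ℂ))) h

lemma gaussF_pow_ringChar {F : Type} [Field F] [Fintype F] (χ : MulChar F ℂ) :
    gaussF (χ ^ ringChar F) = gaussF χ := by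
  have : Fact (ringChar F).Prime := ⟨CharP.char_is_prime F _⟩
  have hp : ringChar F ≠ 0 := (Fact.out : (ringChar F).Prime).ne_zero
  have hbij : Function.Bijective (frobenius F (ringChar F)) :=
    Finite.injective_iff_bijective.mp (frobenius_inj F _)
  refine Finset.sum_bijective _ hbij (fun x => ?_) (fun x _ => ?_)
  · simp [frobenius_def, hp]
  · rw [frobenius_def, psiF_pow_ringChar, MulChar.pow_apply' _ hp, map_pow]

lemma gaussF_pow_ringChar_pow {F : Type} [Field F] [Fintype F] (χ : MulChar F ℂ) (n : ℕ) :
    gaussF (χ ^ ringChar F ^ n) = gaussF χ := by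
  induction n with
  | zero => simp
  | succ n ih => rw [pow_succ, pow_mul, gaussF_pow_ringChar, ih]

lemma exists_pow_two_pow_eq {u q : ℕ} (hu : 2 ≤ u) (hmod : q % 2 ^ (u + 1) = 2 ^ u + 1) (k : ℕ) :
    ∃ m, q ^ 2 ^ k = 1 + 2 ^ (u + k) * (2 * m + 1) := by
  induction k with
  | zero =>
    refine ⟨q / 2 ^ (u + 1), ?_⟩
    have h := Nat.mod_add_div q (2 ^ (u + 1))
    rw [hmod] at h
    simp only [pow_zero, pow_one, add_zero]
    conv_lhs => rw [← h]
    ring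
  | succ k ih =>
    obtain ⟨m, hm⟩ := ih
    obtain ⟨v, rfl⟩ := Nat.exists_eq_add_of_le hu
    refine ⟨m + 2 ^ (v + k) * (2 * m + 1) ^ 2, ?_⟩
    rw [pow_succ, pow_mul, hm]
    ring

/-- The powers of `q` represent all residue classes modulo `2 ^ s` that are `1` modulo `2 ^ u`. -/
lemma exists_pow_modEq {u q : ℕ} (hu : 2 ≤ u) (hmod : q % 2 ^ (u + 1) = 2 ^ u + 1)
    (ℓ k : ℕ) : ∃ j, q ^ j ≡ 2 ^ u * ℓ + 1 [MOD 2 ^ (u + k)] := by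
  induction k with
  | zero =>
    refine ⟨0, ?_⟩
    simp [Nat.ModEq, Nat.add_mod]
  | succ k ih =>
    obtain ⟨j, hj⟩ := ih
    obtain ⟨m, hm⟩ := exists_pow_two_pow_eq hu hmod k
    obtain ⟨c, hc⟩ := Nat.modEq_iff_dvd.mp hj.symm
    push_cast at hc
    rcases Int.even_or_odd' c with ⟨d, rfl | rfl⟩
    · refine ⟨j, (Nat.modEq_iff_dvd.mpr ⟨d, ?_⟩).symm⟩
      push_cast
      rw [hc]
      ring
    · obtain ⟨v, rfl⟩ := Nat.exists_eq_add_of_le hu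
      have hq : (q : ℤ) ^ j = 2 ^ (2 + v) * ℓ + 1 + 2 ^ (2 + v + k) * (2 * d + 1) := by
        linear_combination hc
      refine ⟨j + 2 ^ k, (Nat.modEq_iff_dvd.mpr
        ⟨d + m + 1 + 2 ^ (1 + v) * (ℓ + 2 ^ k * (2 * d + 1)) * (2 * m + 1), ?_⟩).symm⟩
      have hm' : (q : ℤ) ^ 2 ^ k = 1 + 2 ^ (2 + v + k) * (2 * m + 1) := by exact_mod_cast hm
      push_cast
      rw [pow_add, hq, hm']
      ring

/-- Let `u ≥ 2`, `q` a prime power with `q ≡ 2^u + 1 (mod 2^(u+1))`, `t ≥ u+1`,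
`N = 2^t`, `f = 2^(t-u)`.  If `χ` is a multiplicative character of order `N` of
`F_{q^f}`, then `G_{q^f}(χ^(2^u ℓ + 1)) = G_{q^f}(χ)` for every `ℓ ≥ 0`. -/
theorem gauss_sum_invariant_under_power
    (u : ℕ) (hu : 2 ≤ u) (q : ℕ) (hq : IsPrimePow q)
    (hmod : q % 2 ^ (u + 1) = 2 ^ u + 1)
    (t : ℕ) (ht : u + 1 ≤ t)
    (K : Type) [Field K] [Fintype K] (hK : Fintype.card K = q ^ (2 ^ (t - u)))
    (χ : MulChar K ℂ) (hχ : orderOf χ = 2 ^ t)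
    (ℓ : ℕ) :
    gaussF (χ ^ (2 ^ u * ℓ + 1)) = gaussF χ := by
  obtain ⟨p, r, hp, hr, rfl⟩ := hq
  have hp' : p.Prime := hp.nat_prime
  obtain ⟨n, hchar, hcard⟩ := FiniteField.card K (ringChar K)
  have hpc : p = ringChar K := by
    rw [hK, ← pow_mul] at hcard
    have hdvd : p ∣ ringChar K ^ (n : ℕ) :=
      hcard ▸ dvd_pow_self p (Nat.mul_ne_zero hr.ne' (pow_ne_zero _ two_ne_zero))
    exact (Nat.prime_dvd_prime_iff_eq hp' hchar).mp (hp'.dvd_of_dvd_pow hdvd)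
  obtain ⟨k, rfl⟩ := Nat.exists_eq_add_of_le (Nat.le_of_succ_le ht)
  obtain ⟨j, hj⟩ := exists_pow_modEq hu hmod ℓ k
  rw [← hχ] at hj
  rw [← pow_eq_pow_iff_modEq.mpr hj, ← pow_mul, hpc, gaussF_pow_ringChar_pow]
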